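/- Let D = (a,b) with a < b and let (X_t)_{t∈[0,1]} be a zero-mean Gaussian process with càdlàg paths, X_0 = 0, X_t non-degenerate for every t ∈ (0,1], and μ_t < ∞ for every t ∈ (0,1]. Then lim_{t↓0} ((b−a) − Q_D(t)) / μ_t = 2. -/

import Mathlib

open MeasureTheory ProbabilityTheory Filter Set

/-- A real-valued function on `[0,1]` is càdlàg: right-continuous on `[0,1)` and
with left limits on `(0,1]`. -/
def IsCadlagPath (f : ℝ → ℝ) : Prop :=
  (∀ t ∈ Set.Ico (0:ℝ) 1, ContinuousWithinAt f (Set.Ici t) t) ∧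
  (∀ t ∈ Set.Ioc (0:ℝ) 1, ∃ l, Filter.Tendsto f (nhdsWithin t (Set.Iio t)) (nhds l))

/-- `(X_t)_{t∈[0,1]}` is a zero-mean Gaussian process: every finite linear combination
`∑ᵢ cᵢ X_{tᵢ}` has a centered Gaussian distribution. -/
def IsZeroMeanGaussianProcess {Ω : Type*} [MeasureSpace Ω] (X : ℝ → Ω → ℝ) : Prop :=
  ∀ (n : ℕ) (ts : Fin n → ℝ), (∀ i, ts i ∈ Set.Icc (0:ℝ) 1) → ∀ (c : Fin n → ℝ),
    ∃ v : NNReal, Measure.map (fun ω => ∑ i, c i * X (ts i) ω) ℙ =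
      ProbabilityTheory.gaussianReal 0 v

/-- Scale-invariant form of Fernique's theorem: the second moment of the norm under a
rotation-invariant law is bounded by the square of any upper quartile. -/
lemma exists_lintegral_sq_norm_le_of_map_rotation_eq_self :
    ∃ K : ℝ, 0 ≤ K ∧ ∀ (n : ℕ) (ν : Measure (Fin n → ℝ)) [IsProbabilityMeasure ν],
      (ν.prod ν).map (ContinuousLinearMap.rotation (-(Real.pi / 4))) = ν.prod ν →
      ∀ r : ℝ, 0 < r → ENNReal.ofReal (3 / 4) ≤ ν {x | ‖x‖ ≤ r} →
        ∫⁻ x, ENNReal.ofReal (‖x‖ ^ 2) ∂ν ≤ ENNReal.ofReal (K * r ^ 2) := by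
  set c : ENNReal := ENNReal.ofReal (3 / 4) with hc
  have hc_gt : 2⁻¹ < c := by
    rw [hc, show (2⁻¹ : ENNReal) = ENNReal.ofReal 2⁻¹ by
      rw [ENNReal.ofReal_inv_of_pos (by norm_num)]; simp,
      ENNReal.ofReal_lt_ofReal_iff (by norm_num)]
    norm_num
  have hc_lt : c < 1 := by
    rw [hc, ENNReal.ofReal_lt_one]
    norm_num
  have hsub : 1 - c = ENNReal.ofReal (1 / 4) := by
    rw [hc, ← ENNReal.ofReal_one, ← ENNReal.ofReal_sub _ (by norm_num)]
    norm_num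
  have hratio : (c / (1 - c)).toReal = 3 := by
    rw [hsub, hc, ENNReal.toReal_div, ENNReal.toReal_ofReal (by norm_num),
      ENNReal.toReal_ofReal (by norm_num)]
    norm_num
  set L := Fernique.logRatio c
  have hL : 0 < L := Fernique.logRatio_pos hc_gt hc_lt
  set B := ENNReal.ofReal (Real.exp L) +
    ∑' n : ℕ, ENNReal.ofReal (Real.exp (-2⁻¹ * Real.log (c / (1 - c)).toReal * 2 ^ n)) with hB
  have hB_top : B < ⊤ := by
    refine ENNReal.add_lt_top.mpr ⟨ENNReal.ofReal_lt_top, ?_⟩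
    refine Summable.tsum_ofReal_lt_top <|
      Real.summable_exp_nat_mul_of_ge ?_ (fun i ↦ mod_cast (Nat.lt_pow_self (by simp)).le)
    rw [hratio]
    exact mul_neg_of_neg_of_pos (by norm_num) (Real.log_pos (by norm_num))
  refine ⟨L⁻¹ * B.toReal, by positivity, fun n ν _ hrot r hr hr' ↦ ?_⟩
  calc ∫⁻ x, ENNReal.ofReal (‖x‖ ^ 2) ∂ν
      ≤ ∫⁻ x, ENNReal.ofReal (L⁻¹ * r ^ 2) *
          ENNReal.ofReal (Real.exp (L * r⁻¹ ^ 2 * ‖x‖ ^ 2)) ∂ν := by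
        refine lintegral_mono fun x ↦ ?_
        rw [← ENNReal.ofReal_mul (by positivity)]
        refine ENNReal.ofReal_le_ofReal ?_
        have h := Real.add_one_le_exp (L * r⁻¹ ^ 2 * ‖x‖ ^ 2)
        calc ‖x‖ ^ 2 = L⁻¹ * r ^ 2 * (L * r⁻¹ ^ 2 * ‖x‖ ^ 2) := by field_simp
          _ ≤ _ := by gcongr; linarith
    _ = ENNReal.ofReal (L⁻¹ * r ^ 2) *
          ∫⁻ x, ENNReal.ofReal (Real.exp (L * r⁻¹ ^ 2 * ‖x‖ ^ 2)) ∂ν :=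
        lintegral_const_mul _ (by fun_prop)
    _ ≤ ENNReal.ofReal (L⁻¹ * r ^ 2) * B := by
        gcongr
        exact lintegral_exp_mul_sq_norm_le_of_map_rotation_eq_self hrot hr' hc_gt
    _ = ENNReal.ofReal (L⁻¹ * B.toReal * r ^ 2) := by
        rw [← ENNReal.ofReal_toReal hB_top.ne, ← ENNReal.ofReal_mul (by positivity),
          ENNReal.toReal_ofReal (by positivity)]
        congr 1
        ring

section GaussianVector

variable {Ω : Type*} [MeasureSpace Ω] {X : ℝ → Ω → ℝ}

lemma IsZeroMeanGaussianProcess.exists_map_sum_eq_gaussianReal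
    (hX : IsZeroMeanGaussianProcess X) {ι : Type*} [Fintype ι] {s : ι → ℝ}
    (hs : ∀ i, s i ∈ Icc (0 : ℝ) 1) (c : ι → ℝ) :
    ∃ v, (ℙ : Measure Ω).map (fun ω ↦ ∑ i, c i * X (s i) ω) = gaussianReal 0 v := by
  let e := (Fintype.equivFin ι).symm
  obtain ⟨v, hv⟩ := hX _ (s ∘ e) (fun i ↦ hs _) (c ∘ e)
  refine ⟨v, ?_⟩
  rw [← hv]
  congr with ω
  exact (Equiv.sum_comp e fun i ↦ c i * X (s i) ω).symm

lemma IsZeroMeanGaussianProcess.aemeasurable (hX : IsZeroMeanGaussianProcess X) {t : ℝ}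
    (ht : t ∈ Icc (0 : ℝ) 1) : AEMeasurable (X t) ℙ := by
  obtain ⟨v, hv⟩ := hX.exists_map_sum_eq_gaussianReal (s := fun _ : Unit ↦ t) (fun _ ↦ ht) 1
  have : AEMeasurable (fun ω ↦ ∑ _ : Unit, (1 : Unit → ℝ) () * X t ω) ℙ := by
    refine AEMeasurable.of_map_ne_zero ?_
    rw [hv]
    exact IsProbabilityMeasure.ne_zero _
  simpa using this

lemma IsZeroMeanGaussianProcess.aemeasurable_pi (hX : IsZeroMeanGaussianProcess X)
    {ι : Type*} [Countable ι] {s : ι → ℝ} (hs : ∀ i, s i ∈ Icc (0 : ℝ) 1) :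
    AEMeasurable (fun ω i ↦ X (s i) ω) ℙ :=
  aemeasurable_pi_lambda _ fun i ↦ hX.aemeasurable (hs i)

lemma IsZeroMeanGaussianProcess.exists_map_map_strongDual
    (hX : IsZeroMeanGaussianProcess X) {ι : Type*} [Fintype ι] {s : ι → ℝ}
    (hs : ∀ i, s i ∈ Icc (0 : ℝ) 1) (L : StrongDual ℝ (ι → ℝ)) :
    ∃ v, ((ℙ : Measure Ω).map (fun ω i ↦ X (s i) ω)).map L = gaussianReal 0 v := by
  classical
  obtain ⟨v, hv⟩ := hX.exists_map_sum_eq_gaussianReal hs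
    (fun i ↦ L (Pi.single i 1))
  refine ⟨v, ?_⟩
  rw [AEMeasurable.map_map_of_aemeasurable (by fun_prop) (hX.aemeasurable_pi hs), ← hv]
  congr with ω
  simp only [Function.comp_apply]
  have := L.toLinearMap.pi_apply_eq_sum_univ (fun i ↦ X (s i) ω)
  simp only [ContinuousLinearMap.coe_coe, smul_eq_mul] at this
  rw [this]
  refine Finset.sum_congr rfl fun i _ ↦ ?_
  rw [mul_comm]
  congr
  ext j
  simp [Pi.single_apply, eq_comm]

lemma IsZeroMeanGaussianProcess.map_rotation_eq_self
    (hX : IsZeroMeanGaussianProcess X) {ι : Type*} [Fintype ι] {s : ι → ℝ}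
    (hs : ∀ i, s i ∈ Icc (0 : ℝ) 1) (θ : ℝ) :
    (((ℙ : Measure Ω).map (fun ω i ↦ X (s i) ω)).prod
      ((ℙ : Measure Ω).map (fun ω i ↦ X (s i) ω))).map (ContinuousLinearMap.rotation θ) =
    ((ℙ : Measure Ω).map (fun ω i ↦ X (s i) ω)).prod
      ((ℙ : Measure Ω).map (fun ω i ↦ X (s i) ω)) := by
  have : IsGaussian ((ℙ : Measure Ω).map (fun ω i ↦ X (s i) ω)) :=
    isGaussian_of_map_eq_gaussianReal fun L ↦ ⟨0, hX.exists_map_map_strongDual hs L⟩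
  refine IsGaussian.map_rotation_eq_self_of_forall_strongDual_eq_zero (fun L ↦ ?_) θ
  obtain ⟨v, hv⟩ := hX.exists_map_map_strongDual hs L
  have h := integral_id_gaussianReal (μ := 0) (v := v)
  rw [← hv, integral_map (by fun_prop) (by fun_prop)] at h
  exact h

variable [IsProbabilityMeasure (ℙ : Measure Ω)]

lemma IsZeroMeanGaussianProcess.map_neg_eq
    (hX : IsZeroMeanGaussianProcess X) {ι : Type*} [Fintype ι] {s : ι → ℝ}
    (hs : ∀ i, s i ∈ Icc (0 : ℝ) 1) :
    (ℙ : Measure Ω).map (fun ω i ↦ X (s i) ω) = (ℙ : Measure Ω).map (fun ω i ↦ -X (s i) ω) := by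
  have hm := hX.aemeasurable_pi hs
  have hneg : (ℙ : Measure Ω).map (fun ω i ↦ -X (s i) ω) =
      ((ℙ : Measure Ω).map (fun ω i ↦ X (s i) ω)).map (fun x ↦ -x) := by
    rw [AEMeasurable.map_map_of_aemeasurable (by fun_prop) hm]
    rfl
  have := Measure.isProbabilityMeasure_map hm
  rw [hneg]
  have hL := hX.exists_map_map_strongDual hs
  generalize (ℙ : Measure Ω).map (fun ω i ↦ X (s i) ω) = ν at *
  have : IsProbabilityMeasure (ν.map (fun x ↦ -x)) :=
    Measure.isProbabilityMeasure_map (by fun_prop)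
  refine Measure.ext_of_charFunDual ?_
  ext L
  rw [charFunDual_eq_charFun_map_one, charFunDual_eq_charFun_map_one]
  congr 1
  obtain ⟨v, hv⟩ := hL L
  rw [Measure.map_map (by fun_prop) (by fun_prop), show L ∘ (fun x ↦ -x) = (fun x ↦ -x) ∘ L by
    ext; simp, ← Measure.map_map (by fun_prop) (by fun_prop), hv, gaussianReal_map_neg, neg_zero]

lemma IsZeroMeanGaussianProcess.identDistrib_neg
    (hX : IsZeroMeanGaussianProcess X) {s : ℕ → ℝ} (hs : ∀ i, s i ∈ Icc (0 : ℝ) 1) :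
    IdentDistrib (fun ω i ↦ X (s i) ω) (fun ω i ↦ -X (s i) ω) (ℙ : Measure Ω) ℙ := by
  have hm := hX.aemeasurable_pi hs
  refine ⟨hm, hm.neg, ?_⟩
  refine (map_eq_iff_forall_finset_map_restrict_eq (X := fun i ω ↦ X (s i) ω)
    (Y := fun i ω ↦ -X (s i) ω) hm hm.neg).2 fun I ↦ ?_
  exact hX.map_neg_eq (s := fun i : I ↦ s i) fun i ↦ hs _

end GaussianVector

section CadlagPath

variable {f : ℝ → ℝ}

lemma IsCadlagPath.neg (hf : IsCadlagPath f) : IsCadlagPath (fun s ↦ -f s) :=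
  ⟨fun t ht ↦ (hf.1 t ht).neg, fun t ht ↦
    let ⟨l, hl⟩ := hf.2 t ht
    ⟨-l, hl.neg⟩⟩

lemma IsCadlagPath.exists_forall_abs_le (hf : IsCadlagPath f) :
    ∃ C, ∀ s ∈ Icc (0 : ℝ) 1, |f s| ≤ C := by
  refine isCompact_Icc.induction_on (p := fun A ↦ ∃ C, ∀ s ∈ A, |f s| ≤ C)
    ⟨0, by simp⟩ (fun A B hAB ⟨C, hC⟩ ↦ ⟨C, fun s hs ↦ hC s (hAB hs)⟩) ?_ ?_
  · rintro A B ⟨C, hC⟩ ⟨C', hC'⟩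
    exact ⟨max C C', fun s hs ↦ hs.elim (fun h ↦ (hC s h).trans (le_max_left _ _))
      (fun h ↦ (hC' s h).trans (le_max_right _ _))⟩
  · intro x hx
    obtain ⟨C, hC⟩ : ∃ C, ∀ᶠ s in nhdsWithin x (Ici x), s ∈ Icc (0 : ℝ) 1 → |f s| ≤ C := by
      rcases hx.2.eq_or_lt with rfl | h
      · refine ⟨|f 1|, eventually_nhdsWithin_of_forall fun s hs hs' ↦ ?_⟩
        rw [le_antisymm hs'.2 hs]
      · refine ⟨|f x| + 1, ?_⟩
        filter_upwards [(hf.1 x ⟨hx.1, h⟩).abs.eventually_lt_const (lt_add_one _)] with s hs _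
        exact hs.le
    obtain ⟨C', hC'⟩ : ∃ C, ∀ᶠ s in nhdsWithin x (Iio x), s ∈ Icc (0 : ℝ) 1 → |f s| ≤ C := by
      rcases hx.1.eq_or_lt with rfl | h
      · exact ⟨0, eventually_nhdsWithin_of_forall fun s hs hs' ↦ absurd hs'.1 (not_le.2 hs)⟩
      · obtain ⟨l, hl⟩ := hf.2 x ⟨h, hx.2⟩
        refine ⟨|l| + 1, ?_⟩
        filter_upwards [hl.abs.eventually_lt_const (lt_add_one _)] with s hs _
        exact hs.le
    refine ⟨{s | s ∈ Icc (0 : ℝ) 1 → |f s| ≤ max C C'} ∩ Icc 0 1, ?_, max C C',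
      fun s hs ↦ hs.1 hs.2⟩
    refine inter_mem (mem_nhdsWithin_of_mem_nhds ?_) self_mem_nhdsWithin
    rw [← nhdsLT_sup_nhdsGE]
    refine ⟨?_, ?_⟩
    · filter_upwards [hC'] with s hs h using (hs h).trans (le_max_right _ _)
    · filter_upwards [hC] with s hs h using (hs h).trans (le_max_left _ _)

lemma IsCadlagPath.bddAbove_range {ι : Sort*} (hf : IsCadlagPath f) {d : ι → ℝ}
    (hd : ∀ i, d i ∈ Icc (0 : ℝ) 1) : BddAbove (range fun i ↦ f (d i)) := by
  obtain ⟨C, hC⟩ := hf.exists_forall_abs_le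
  refine ⟨C, ?_⟩
  rintro _ ⟨i, rfl⟩
  exact (le_abs_self _).trans (hC _ (hd i))

lemma IsCadlagPath.bddAbove_range_Icc (hf : IsCadlagPath f) {t : ℝ} (ht : t ≤ 1) :
    BddAbove (range fun s : Icc (0 : ℝ) t ↦ f s) :=
  hf.bddAbove_range fun s ↦ ⟨s.2.1, s.2.2.trans ht⟩

lemma IsCadlagPath.le_iSup_Icc (hf : IsCadlagPath f) {s t : ℝ} (ht : t ≤ 1)
    (hs : s ∈ Icc 0 t) : f s ≤ ⨆ s : Icc (0 : ℝ) t, f s :=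
  le_ciSup (hf.bddAbove_range_Icc ht) ⟨s, hs⟩

/-- A sequence in `[0,t]` that starts at `t` and accumulates at every earlier time from the
right. -/
lemma exists_seq_rightDense {t : ℝ} (ht : 0 < t) :
    ∃ d : ℕ → ℝ, (∀ n, d n ∈ Icc 0 t) ∧ d 0 = t ∧
      ∀ s ∈ Ico 0 t, ∀ u, s < u → ∃ n, d n ∈ Ioo s u := by
  obtain ⟨e, he⟩ := TopologicalSpace.exists_dense_seq ℝ
  refine ⟨fun n ↦ Nat.casesOn n t fun k ↦ max 0 (min t (e k)), ?_, rfl, ?_⟩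
  · rintro (_ | k)
    · exact ⟨ht.le, le_rfl⟩
    · exact ⟨le_max_left _ _, max_le ht.le (min_le_left _ _)⟩
  · intro s hs u hu
    obtain ⟨k, hk⟩ := he.exists_mem_open isOpen_Ioo (nonempty_Ioo.2 (lt_min hu hs.2))
    refine ⟨k + 1, ?_⟩
    have h1 : e k < t := hk.2.trans_le (min_le_right _ _)
    have h2 : 0 ≤ e k := hs.1.trans hk.1.le
    change max 0 (min t (e k)) ∈ Ioo s u
    rw [min_eq_right h1.le, max_eq_right h2]
    exact ⟨hk.1, hk.2.trans_le (min_le_left _ _)⟩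

lemma IsCadlagPath.iSup_Icc_eq_iSup_seq (hf : IsCadlagPath f) {t : ℝ} (ht : t ∈ Ioc (0 : ℝ) 1)
    {d : ℕ → ℝ} (hd : ∀ n, d n ∈ Icc 0 t) (hd0 : d 0 = t)
    (hdense : ∀ s ∈ Ico 0 t, ∀ u, s < u → ∃ n, d n ∈ Ioo s u) :
    ⨆ s : Icc (0 : ℝ) t, f s = ⨆ n, f (d n) := by
  have hbdd : BddAbove (range fun n ↦ f (d n)) :=
    hf.bddAbove_range fun n ↦ ⟨(hd n).1, (hd n).2.trans ht.2⟩
  have : Nonempty (Icc (0 : ℝ) t) := ⟨⟨0, le_rfl, ht.1.le⟩⟩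
  refine le_antisymm (ciSup_le ?_) (ciSup_le fun n ↦ hf.le_iSup_Icc ht.2 (hd n))
  rintro ⟨s, hs⟩
  rcases hs.2.eq_or_lt with rfl | hst
  · simpa [hd0] using le_ciSup hbdd 0
  · by_contra! hlt
    obtain ⟨u, hu, hu'⟩ := mem_nhdsGE_iff_exists_Ico_subset.1
      ((hf.1 s ⟨hs.1, hst.trans_le ht.2⟩).eventually_const_lt hlt)
    obtain ⟨n, hn⟩ := hdense s ⟨hs.1, hst⟩ u hu
    exact (le_ciSup hbdd n).not_gt (hu' ⟨hn.1.le, hn.2⟩)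

lemma IsCadlagPath.tendsto_iSup_Icc (hf : IsCadlagPath f) :
    Tendsto (fun t ↦ ⨆ s : Icc (0 : ℝ) t, f s) (nhdsWithin 0 (Ioc 0 1)) (nhds (f 0)) := by
  refine tendsto_order.2 ⟨fun l hl ↦ ?_, fun l hl ↦ ?_⟩
  · filter_upwards [self_mem_nhdsWithin] with t ht
    exact hl.trans_le (hf.le_iSup_Icc ht.2 ⟨le_rfl, ht.1.le⟩)
  · obtain ⟨l', hl', hl'l⟩ := exists_between hl
    obtain ⟨u, hu, hu'⟩ := mem_nhdsGE_iff_exists_Ico_subset.1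
      ((hf.1 0 ⟨le_rfl, one_pos⟩).eventually_lt_const hl')
    filter_upwards [self_mem_nhdsWithin, mem_nhdsWithin_of_mem_nhds (Iio_mem_nhds hu)]
      with t ht htu
    have : Nonempty (Icc (0 : ℝ) t) := ⟨⟨0, le_rfl, ht.1.le⟩⟩
    exact (ciSup_le fun s ↦ (hu' ⟨s.2.1, s.2.2.trans_lt htu⟩).le).trans_lt hl'l

end CadlagPath

section Fubini

variable {Ω : Type*} [MeasurableSpace Ω] {P : Measure Ω} [IsProbabilityMeasure P] {a b : ℝ}
  {U V : Ω → ℝ} {E : ℝ → Set Ω}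

lemma integral_Ioo_measure_eq_of_measurable (hU : Measurable U) (hV : Measurable V)
    (hU0 : 0 ≤ᵐ[P] U) (hV0 : 0 ≤ᵐ[P] V)
    (hE : ∀ x, ∀ᵐ ω ∂P, (U ω < b - x → V ω < x - a → ω ∈ E x) ∧
      (ω ∈ E x → U ω ≤ b - x ∧ V ω ≤ x - a)) :
    ∫ x in Ioo a b, (P (E x)).toReal = ∫ ω, max (b - a - U ω - V ω) 0 ∂P := by
  let S : Set (ℝ × Ω) := {p | U p.2 < b - p.1} ∩ {p | V p.2 < p.1 - a}
  have hS : MeasurableSet S :=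
    (measurableSet_lt (by fun_prop) (by fun_prop)).inter
      (measurableSet_lt (by fun_prop) (by fun_prop))
  have hEU : ∀ᵐ x ∂(volume.restrict (Ioo a b)), P {ω | U ω = b - x} = 0 := by
    refine ae_restrict_of_ae (((Measure.countable_meas_level_set_pos (μ := P) hU).image
      (fun y ↦ b - y)).ae_notMem _ |>.mono fun x hx ↦ ?_)
    by_contra h
    exact hx ⟨b - x, pos_iff_ne_zero.2 h, by ring⟩
  have hEV : ∀ᵐ x ∂(volume.restrict (Ioo a b)), P {ω | V ω = x - a} = 0 := by
    refine ae_restrict_of_ae (((Measure.countable_meas_level_set_pos (μ := P) hV).image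
      (fun y ↦ y + a)).ae_notMem _ |>.mono fun x hx ↦ ?_)
    by_contra h
    exact hx ⟨x - a, pos_iff_ne_zero.2 h, by ring⟩
  have hES : ∀ᵐ x ∂(volume.restrict (Ioo a b)), P (E x) = P (Prod.mk x ⁻¹' S) := by
    filter_upwards [hEU, hEV] with x hx1 hx2
    refine measure_congr ?_
    have h1 : ∀ᵐ ω ∂P, U ω ≠ b - x := measure_eq_zero_iff_ae_notMem.1 hx1
    have h2 : ∀ᵐ ω ∂P, V ω ≠ x - a := measure_eq_zero_iff_ae_notMem.1 hx2
    filter_upwards [h1, h2, hE x] with ω h1 h2 h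
    refine propext ⟨fun hω ↦ ?_, fun hω ↦ h.1 hω.1 hω.2⟩
    exact ⟨lt_of_le_of_ne (h.2 hω).1 h1, lt_of_le_of_ne (h.2 hω).2 h2⟩
  calc ∫ x in Ioo a b, (P (E x)).toReal
      = ∫ x in Ioo a b, (P (Prod.mk x ⁻¹' S)).toReal :=
        integral_congr_ae (hES.mono fun x hx ↦ by simp only [hx])
    _ = (∫⁻ x in Ioo a b, P (Prod.mk x ⁻¹' S)).toReal :=
        integral_toReal (measurable_measure_prodMk_left hS).aemeasurable
          (ae_of_all _ fun x ↦ measure_lt_top _ _)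
    _ = (∫⁻ ω, ENNReal.ofReal (b - a - U ω - V ω) ∂P).toReal := by
        rw [← Measure.prod_apply hS, Measure.prod_apply_symm hS]
        congr 1
        refine lintegral_congr_ae ?_
        filter_upwards [hU0, hV0] with ω h1 h2
        have : (fun x ↦ (x, ω)) ⁻¹' S = Ioo (a + V ω) (b - U ω) := by
          ext x
          simp only [S, mem_preimage, mem_inter_iff, mem_ofPred_eq, mem_Ioo]
          constructor <;> rintro ⟨h, h'⟩ <;> constructor <;> linarith
        rw [this, Measure.restrict_apply measurableSet_Ioo, inter_eq_left.2, Real.volume_Ioo]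
        · congr 1
          ring
        · refine Ioo_subset_Ioo ?_ ?_ <;> simp at h1 h2 <;> linarith
    _ = ∫ ω, max (b - a - U ω - V ω) 0 ∂P := by
        rw [integral_eq_lintegral_of_nonneg_ae (f := fun ω ↦ max (b - a - U ω - V ω) 0)
          (ae_of_all _ fun ω ↦ le_max_right _ _) (by fun_prop)]
        congr 1
        refine lintegral_congr fun ω ↦ ?_
        rw [ENNReal.ofReal_max, ENNReal.ofReal_zero, max_eq_left zero_le]

/-- If `E x` agrees with `{U < b - x, V < x - a}` up to the boundary, then the integral of its
probability over `(a,b)` is the expected length of `(a + V, b - U)`. -/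
lemma integral_Ioo_measure_eq (hU : AEMeasurable U P) (hV : AEMeasurable V P)
    (hU0 : ∀ ω, 0 ≤ U ω) (hV0 : ∀ ω, 0 ≤ V ω)
    (hE : ∀ x ω, (U ω < b - x → V ω < x - a → ω ∈ E x) ∧
      (ω ∈ E x → U ω ≤ b - x ∧ V ω ≤ x - a)) :
    ∫ x in Ioo a b, (P (E x)).toReal = ∫ ω, max (b - a - U ω - V ω) 0 ∂P := by
  rw [integral_Ioo_measure_eq_of_measurable (P := P) (E := E) hU.measurable_mk hV.measurable_mk]
  · refine integral_congr_ae ?_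
    filter_upwards [hU.ae_eq_mk, hV.ae_eq_mk] with ω h1 h2
    rw [h1, h2]
  · filter_upwards [hU.ae_eq_mk] with ω h using h ▸ hU0 ω
  · filter_upwards [hV.ae_eq_mk] with ω h using h ▸ hV0 ω
  · intro x
    filter_upwards [hU.ae_eq_mk, hV.ae_eq_mk] with ω h1 h2
    rw [← h1, ← h2]
    exact hE x ω

end Fubini

section RunningSupremum

variable {Ω : Type*} [MeasureSpace Ω] [IsProbabilityMeasure (ℙ : Measure Ω)] {X : ℝ → Ω → ℝ}
  {t : ℝ}

lemma IsZeroMeanGaussianProcess.identDistrib_iSup_Icc_neg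
    (hX : IsZeroMeanGaussianProcess X) (hpath : ∀ ω, IsCadlagPath (fun s ↦ X s ω))
    (ht : t ∈ Ioc (0 : ℝ) 1) :
    IdentDistrib (fun ω ↦ ⨆ s : Icc (0 : ℝ) t, X s ω) (fun ω ↦ ⨆ s : Icc (0 : ℝ) t, -X s ω)
      (ℙ : Measure Ω) ℙ := by
  obtain ⟨d, hd, hd0, hdense⟩ := exists_seq_rightDense ht.1
  have h := (hX.identDistrib_neg fun n ↦ ⟨(hd n).1, (hd n).2.trans ht.2⟩).comp
    (u := fun y : ℕ → ℝ ↦ ⨆ n, y n) (Measurable.iSup fun n ↦ measurable_pi_apply n)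
  convert h using 1
  · ext ω
    exact (hpath ω).iSup_Icc_eq_iSup_seq ht hd hd0 hdense
  · ext ω
    exact (hpath ω).neg.iSup_Icc_eq_iSup_seq ht hd hd0 hdense

/-- The second moment of the range of the process on `[0,t]` is controlled by the square of the
first moment of its supremum. -/
lemma exists_lintegral_sq_iSup_Icc_le :
    ∃ K : ℝ, 0 ≤ K ∧ ∀ {Ω : Type*} [MeasureSpace Ω] [IsProbabilityMeasure (ℙ : Measure Ω)]
      {X : ℝ → Ω → ℝ} {t m : ℝ}, IsZeroMeanGaussianProcess X →
      (∀ ω, IsCadlagPath (fun s ↦ X s ω)) → (∀ ω, X 0 ω = 0) → t ∈ Ioc (0 : ℝ) 1 →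
      Integrable (fun ω ↦ ⨆ s : Icc (0 : ℝ) t, X s ω) (ℙ : Measure Ω) →
      ∫ ω, (⨆ s : Icc (0 : ℝ) t, X s ω) = m → 0 < m →
      ∫⁻ ω, ENNReal.ofReal (((⨆ s : Icc (0 : ℝ) t, X s ω) + ⨆ s : Icc (0 : ℝ) t, -X s ω) ^ 2) ≤
        ENNReal.ofReal (K * m ^ 2) := by
  obtain ⟨K, hK, hK'⟩ := exists_lintegral_sq_norm_le_of_map_rotation_eq_self
  refine ⟨4 * (K * 8 ^ 2), by positivity, ?_⟩
  intro Ω _ _ X t m hX hpath hX0 ht hint hm hmpos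
  set M : Ω → ℝ := fun ω ↦ ⨆ s : Icc (0 : ℝ) t, X s ω with hM
  set N : Ω → ℝ := fun ω ↦ ⨆ s : Icc (0 : ℝ) t, -X s ω with hN
  have hid : IdentDistrib M N ℙ ℙ := hX.identDistrib_iSup_Icc_neg hpath ht
  have hNint : Integrable N ℙ := hid.integrable_iff.1 hint
  have hXM : ∀ ω, ∀ s ∈ Icc 0 t, X s ω ≤ M ω := fun ω s hs ↦ (hpath ω).le_iSup_Icc ht.2 hs
  have hXN : ∀ ω, ∀ s ∈ Icc 0 t, -X s ω ≤ N ω :=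
    fun ω s hs ↦ (hpath ω).neg.le_iSup_Icc ht.2 hs
  have h0 : (0 : ℝ) ∈ Icc 0 t := ⟨le_rfl, ht.1.le⟩
  have hM0 : ∀ ω, 0 ≤ M ω := fun ω ↦ by simpa [hX0] using hXM ω 0 h0
  have hN0 : ∀ ω, 0 ≤ N ω := fun ω ↦ by simpa [hX0] using hXN ω 0 h0
  obtain ⟨d, hd, hd0, hdense⟩ := exists_seq_rightDense ht.1
  have hd' : ∀ n, d n ∈ Icc (0 : ℝ) 1 := fun n ↦ ⟨(hd n).1, (hd n).2.trans ht.2⟩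
  let Y : (k : ℕ) → Ω → (Fin k → ℝ) := fun k ω i ↦ X (d i) ω
  have hY : ∀ k, AEMeasurable (Y k) ℙ := fun k ↦ hX.aemeasurable_pi fun i ↦ hd' i
  have hYle : ∀ k ω, ‖Y k ω‖ ≤ M ω + N ω := by
    refine fun k ω ↦ (pi_norm_le_iff_of_nonneg (add_nonneg (hM0 ω) (hN0 ω))).2 fun i ↦ ?_
    rw [Real.norm_eq_abs]
    refine abs_le'.2 ⟨?_, ?_⟩
    · linarith [hXM ω _ (hd i), hN0 ω]
    · linarith [hXN ω _ (hd i), hM0 ω]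
  have hbdd : ∀ ω, BddAbove (range fun k ↦ ‖Y k ω‖) := by
    rintro ω
    refine ⟨M ω + N ω, ?_⟩
    rintro _ ⟨k, rfl⟩
    exact hYle k ω
  have hmono : ∀ ω, Monotone fun k ↦ ‖Y k ω‖ := by
    refine fun ω k l hkl ↦ (pi_norm_le_iff_of_nonneg (norm_nonneg _)).2 fun i ↦ ?_
    exact norm_le_pi_norm (Y l ω) (Fin.castLE hkl i)
  have hle : ∀ n ω, |X (d n) ω| ≤ ⨆ k, ‖Y k ω‖ := fun n ω ↦
    (norm_le_pi_norm (Y (n + 1) ω) (Fin.last n)).trans (le_ciSup (hbdd ω) (n + 1))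
  have hMle : ∀ ω, M ω ≤ ⨆ k, ‖Y k ω‖ := fun ω ↦
    ((hpath ω).iSup_Icc_eq_iSup_seq ht hd hd0 hdense).trans_le <| ciSup_le fun n ↦ (le_abs_self _).trans (hle n ω)
  have hNle : ∀ ω, N ω ≤ ⨆ k, ‖Y k ω‖ := fun ω ↦
    ((hpath ω).neg.iSup_Icc_eq_iSup_seq ht hd hd0 hdense).trans_le <| ciSup_le fun n ↦ (neg_le_abs _).trans (hle n ω)
  have hmarkov : ENNReal.ofReal (3 / 4) ≤ ℙ {ω | M ω + N ω ≤ 8 * m} := by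
    have h := mul_meas_ge_le_integral_of_nonneg (μ := ℙ) (f := fun ω ↦ M ω + N ω)
      (ae_of_all _ fun ω ↦ add_nonneg (hM0 ω) (hN0 ω)) (hint.add hNint) (8 * m)
    rw [integral_add hint hNint, ← hid.integral_eq, hm] at h
    have h' : (ℙ : Measure Ω).real {ω | 8 * m ≤ M ω + N ω} ≤ 1 / 4 := by
      by_contra! hlt
      nlinarith
    have hone : (1 : ℝ) ≤ (ℙ : Measure Ω).real {ω | M ω + N ω ≤ 8 * m} +
        (ℙ : Measure Ω).real {ω | 8 * m ≤ M ω + N ω} := by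
      refine le_trans ?_ (measureReal_union_le _ _)
      rw [show {ω | M ω + N ω ≤ 8 * m} ∪ {ω | 8 * m ≤ M ω + N ω} = univ from
        eq_univ_of_forall fun ω ↦ (le_total (M ω + N ω) (8 * m)).imp id id, probReal_univ]
    exact ENNReal.ofReal_le_of_le_toReal (show 3 / 4 ≤ (ℙ : Measure Ω).real _ by linarith)
  have hmoment : ∀ k, ∫⁻ ω, ENNReal.ofReal (‖Y k ω‖ ^ 2) ≤
      ENNReal.ofReal (K * (8 * m) ^ 2) := fun k ↦ by
    have := Measure.isProbabilityMeasure_map (hY k)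
    have h := hK' k ((ℙ : Measure Ω).map (Y k)) (hX.map_rotation_eq_self (ι := Fin k) (s := fun i ↦ d i) (fun i ↦ hd' i) _)
      (8 * m) (by positivity) ?_
    · rwa [lintegral_map' (by fun_prop) (hY k)] at h
    · rw [Measure.map_apply_of_aemeasurable (hY k) (measurableSet_le (by fun_prop) (by fun_prop))]
      exact hmarkov.trans (measure_mono fun ω hω ↦ (hYle k ω).trans hω)
  have hlim : Tendsto (fun k ↦ ∫⁻ ω, ENNReal.ofReal (‖Y k ω‖ ^ 2)) atTop
      (nhds (∫⁻ ω, ENNReal.ofReal ((⨆ k, ‖Y k ω‖) ^ 2))) := by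
    refine lintegral_tendsto_of_tendsto_of_monotone (fun k ↦ ?_) (ae_of_all _ fun ω k l hkl ↦ ?_)
      (ae_of_all _ fun ω ↦ ?_)
    · have := hY k
      fun_prop
    · exact ENNReal.ofReal_le_ofReal (pow_le_pow_left₀ (norm_nonneg _) (hmono ω hkl) 2)
    · exact ENNReal.tendsto_ofReal ((tendsto_atTop_ciSup (hmono ω) (hbdd ω)).pow 2)
  calc ∫⁻ ω, ENNReal.ofReal ((M ω + N ω) ^ 2)
      ≤ ∫⁻ ω, ENNReal.ofReal 4 * ENNReal.ofReal ((⨆ k, ‖Y k ω‖) ^ 2) := by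
        refine lintegral_mono fun ω ↦ ?_
        rw [← ENNReal.ofReal_mul (by norm_num)]
        refine ENNReal.ofReal_le_ofReal ?_
        nlinarith [hMle ω, hNle ω, hM0 ω, hN0 ω]
    _ = ENNReal.ofReal 4 * ∫⁻ ω, ENNReal.ofReal ((⨆ k, ‖Y k ω‖) ^ 2) :=
        lintegral_const_mul' _ _ ENNReal.ofReal_ne_top
    _ ≤ ENNReal.ofReal 4 * ENNReal.ofReal (K * (8 * m) ^ 2) := by
        gcongr
        exact le_of_tendsto' hlim hmoment
    _ = ENNReal.ofReal (4 * (K * 8 ^ 2) * m ^ 2) := by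
        rw [← ENNReal.ofReal_mul (by norm_num)]
        congr 1
        ring

end RunningSupremum

/-- Elementary two-sided bound on the expected length removed from an interval of length `c`. -/
lemma abs_sub_integral_max_div_sub_two_le {Ω : Type*} [MeasurableSpace Ω] {P : Measure Ω}
    [IsProbabilityMeasure P] {M N : Ω → ℝ} {c m K : ℝ} (hM : Integrable M P)
    (hN : Integrable N P) (hc : 0 < c) (hm : 0 < m)
    (hK : 0 ≤ K) (hMm : ∫ ω, M ω ∂P = m) (hNm : ∫ ω, N ω ∂P = m)
    (hsq : ∫⁻ ω, ENNReal.ofReal ((M ω + N ω) ^ 2) ∂P ≤ ENNReal.ofReal (K * m ^ 2)) :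
    |(c - ∫ ω, max (c - M ω - N ω) 0 ∂P) / m - 2| ≤ K / c * m := by
  have hsum : Integrable (fun ω ↦ M ω + N ω) P := hM.add hN
  have hsum' : ∫ ω, (M ω + N ω) ∂P = 2 * m := by
    rw [integral_add hM hN, hMm, hNm]
    ring
  have hsub : Integrable (fun ω ↦ c - (M ω + N ω)) P := (integrable_const c).sub hsum
  have hsq_meas : AEStronglyMeasurable (fun ω ↦ (M ω + N ω) ^ 2) P := hsum.1.pow 2
  have hsq0 : 0 ≤ᵐ[P] fun ω ↦ (M ω + N ω) ^ 2 := ae_of_all _ fun ω ↦ sq_nonneg _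
  have hsq_int : Integrable (fun ω ↦ (M ω + N ω) ^ 2) P :=
    (lintegral_ofReal_ne_top_iff_integrable hsq_meas hsq0).1
      (hsq.trans_lt ENNReal.ofReal_lt_top).ne
  have hsq_le : ∫ ω, (M ω + N ω) ^ 2 ∂P ≤ K * m ^ 2 := by
    rw [integral_eq_lintegral_of_nonneg_ae hsq0 hsq_meas]
    exact ENNReal.toReal_le_of_le_ofReal (by positivity) hsq
  have hmax : Integrable (fun ω ↦ max (c - M ω - N ω) 0) P :=
    (((integrable_const c).sub hM).sub hN).pos_part
  have hupper : ∫ ω, (c - (M ω + N ω)) ∂P ≤ ∫ ω, max (c - M ω - N ω) 0 ∂P :=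
    integral_mono hsub hmax fun ω ↦
      le_max_of_le_left (by simp only; linarith)
  have hlower : ∫ ω, max (c - M ω - N ω) 0 ∂P ≤
      ∫ ω, (c - (M ω + N ω) + (M ω + N ω) ^ 2 / c) ∂P := by
    refine integral_mono hmax (hsub.add (hsq_int.div_const c))
      fun ω ↦ max_le ?_ ?_
    · have : 0 ≤ (M ω + N ω) ^ 2 / c := by positivity
      linarith
    · have : c - (M ω + N ω) + (M ω + N ω) ^ 2 / c =
          ((c - (M ω + N ω) / 2) ^ 2 + 3 * ((M ω + N ω) / 2) ^ 2) / c := by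
        field_simp
        ring
      rw [this]
      positivity
  rw [integral_add hsub (hsq_int.div_const c),
    integral_div] at hlower
  rw [integral_sub (integrable_const c) hsum, hsum'] at hupper hlower
  simp only [integral_const, probReal_univ, one_smul] at hupper hlower
  have hdiv : (∫ ω, (M ω + N ω) ^ 2 ∂P) / c ≤ K / c * m * m := by
    calc (∫ ω, (M ω + N ω) ^ 2 ∂P) / c ≤ K * m ^ 2 / c := by gcongr
      _ = K / c * m * m := by ring
  have hKc : 0 ≤ K / c * m * m := by positivity
  rw [div_sub' hm.ne', abs_div, abs_of_pos hm, div_le_iff₀ hm, abs_le]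
  constructor <;> linarith

/-- For a zero-mean Gaussian process with càdlàg paths, `X₀ = 0`,
non-degenerate marginals and finite expected running supremum, the spectral heat
content of `D = (a,b)` satisfies `lim_{t↓0} ((b-a) - Q_D(t)) / μ_t = 2`. -/
theorem spectral_heat_content_gaussian_limit
    {Ω : Type*} [MeasureSpace Ω] [IsProbabilityMeasure (ℙ : Measure Ω)]
    (a b : ℝ) (hab : a < b) (X : ℝ → Ω → ℝ)
    (hGauss : IsZeroMeanGaussianProcess X)
    (hpath : ∀ ω, IsCadlagPath (fun s => X s ω))
    (hX0 : ∀ ω, X 0 ω = 0)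
    (hnondeg : ∀ t ∈ Set.Ioc (0:ℝ) 1, 0 < ℙ {ω | X t ω ≠ 0})
    (hμfin : ∀ t ∈ Set.Ioc (0:ℝ) 1,
      Integrable (fun ω => ⨆ s : Set.Icc (0:ℝ) t, X s.1 ω) ℙ)
    (μ Q : ℝ → ℝ)
    (hμ : ∀ t, μ t = ∫ ω, (⨆ s : Set.Icc (0:ℝ) t, X s.1 ω) ∂ℙ)
    (hQ : ∀ t, Q t = ∫ x in Set.Ioo a b,
      (ℙ {ω | ∀ s ∈ Set.Icc (0:ℝ) t, X s ω + x ∈ Set.Ioo a b}).toReal) :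
    Tendsto (fun t => ((b - a) - Q t) / μ t) (nhdsWithin 0 (Set.Ioc 0 1)) (nhds 2) := by
  obtain ⟨K, hK, hK'⟩ := exists_lintegral_sq_iSup_Icc_le
  have hMint : ∀ t, t ∈ Ioc (0 : ℝ) 1 →
      Integrable (fun ω ↦ ⨆ s : Icc (0 : ℝ) t, X s ω) ℙ := hμfin
  have hXM : ∀ t ∈ Ioc (0 : ℝ) 1, ∀ ω, ∀ s ∈ Icc 0 t, X s ω ≤ ⨆ s : Icc (0 : ℝ) t, X s ω :=
    fun t ht ω s hs ↦ (hpath ω).le_iSup_Icc ht.2 hs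
  have hXN : ∀ t ∈ Ioc (0 : ℝ) 1, ∀ ω, ∀ s ∈ Icc 0 t, -X s ω ≤ ⨆ s : Icc (0 : ℝ) t, -X s ω :=
    fun t ht ω s hs ↦ (hpath ω).neg.le_iSup_Icc ht.2 hs
  have hM0 : ∀ t ∈ Ioc (0 : ℝ) 1, ∀ ω, 0 ≤ ⨆ s : Icc (0 : ℝ) t, X s ω :=
    fun t ht ω ↦ by simpa [hX0] using hXM t ht ω 0 ⟨le_rfl, ht.1.le⟩
  have hN0 : ∀ t ∈ Ioc (0 : ℝ) 1, ∀ ω, 0 ≤ ⨆ s : Icc (0 : ℝ) t, -X s ω :=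
    fun t ht ω ↦ by simpa [hX0] using hXN t ht ω 0 ⟨le_rfl, ht.1.le⟩
  have hid := fun t (ht : t ∈ Ioc (0 : ℝ) 1) ↦ hGauss.identDistrib_iSup_Icc_neg hpath ht
  have hNint : ∀ t, t ∈ Ioc (0 : ℝ) 1 →
      Integrable (fun ω ↦ ⨆ s : Icc (0 : ℝ) t, -X s ω) ℙ :=
    fun t ht ↦ (hid t ht).integrable_iff.1 (hMint t ht)
  have hμN : ∀ t ∈ Ioc (0 : ℝ) 1, μ t = ∫ ω, (⨆ s : Icc (0 : ℝ) t, -X s ω) ∂ℙ :=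
    fun t ht ↦ (hμ t).trans (hid t ht).integral_eq
  have hμpos : ∀ t ∈ Ioc (0 : ℝ) 1, 0 < μ t := by
    intro t ht
    have hnonneg : 0 ≤ μ t := by
      rw [hμ]
      exact integral_nonneg (hM0 t ht)
    refine hnonneg.lt_of_ne fun h ↦ (hnondeg t ht).ne' ?_
    have h1 := (integral_eq_zero_iff_of_nonneg (hM0 t ht) (hMint t ht)).1 ((hμ t).symm.trans h.symm)
    have h2 := (integral_eq_zero_iff_of_nonneg (hN0 t ht) (hNint t ht)).1
      ((hμN t ht).symm.trans h.symm)
    refine measure_eq_zero_iff_ae_notMem.2 ?_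
    filter_upwards [h1, h2] with ω h1 h2
    have h1' := hXM t ht ω t ⟨ht.1.le, le_rfl⟩
    have h2' := hXN t ht ω t ⟨ht.1.le, le_rfl⟩
    rw [h1, Pi.zero_apply] at h1'
    rw [h2, Pi.zero_apply] at h2'
    exact not_not.2 (le_antisymm h1' (by linarith))
  have hμlim : Tendsto μ (nhdsWithin 0 (Ioc 0 1)) (nhds 0) := by
    have h1 : (1 : ℝ) ∈ Ioc (0 : ℝ) 1 := ⟨one_pos, le_rfl⟩
    have h := tendsto_integral_filter_of_dominated_convergence (μ := (ℙ : Measure Ω))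
      (l := nhdsWithin 0 (Ioc (0 : ℝ) 1)) (F := fun t ω ↦ ⨆ s : Icc (0 : ℝ) t, X s ω)
      (f := fun ω ↦ X 0 ω) (fun ω ↦ ⨆ s : Icc (0 : ℝ) (1 : ℝ), X s ω)
      (eventually_nhdsWithin_of_forall fun t ht ↦ (hMint t ht).1)
      (eventually_nhdsWithin_of_forall fun t ht ↦ ae_of_all _ fun ω ↦ ?_)
      (hMint 1 h1) (ae_of_all _ fun ω ↦ (hpath ω).tendsto_iSup_Icc)
    · simp only [hX0, integral_zero] at h
      exact h.congr fun t ↦ (hμ t).symm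
    · have : Nonempty (Icc (0 : ℝ) t) := ⟨⟨0, le_rfl, ht.1.le⟩⟩
      rw [Real.norm_of_nonneg (hM0 t ht ω)]
      exact ciSup_le fun s ↦ hXM 1 h1 ω s ⟨s.2.1, s.2.2.trans ht.2⟩
  have hQ' : ∀ t ∈ Ioc (0 : ℝ) 1, Q t = ∫ ω, max (b - a - (⨆ s : Icc (0 : ℝ) t, X s ω) -
      ⨆ s : Icc (0 : ℝ) t, -X s ω) 0 ∂ℙ := by
    intro t ht
    have : Nonempty (Icc (0 : ℝ) t) := ⟨⟨0, le_rfl, ht.1.le⟩⟩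
    rw [hQ]
    refine integral_Ioo_measure_eq (hMint t ht).aemeasurable (hNint t ht).aemeasurable
      (hM0 t ht) (hN0 t ht) fun x ω ↦ ⟨fun h1 h2 s hs ↦ ?_, fun h ↦ ⟨?_, ?_⟩⟩
    · have := hXM t ht ω s hs
      have := hXN t ht ω s hs
      constructor <;> linarith
    · exact ciSup_le fun s ↦ by linarith [(h s s.2).2]
    · exact ciSup_le fun s ↦ by linarith [(h s s.2).1]
  have hc : 0 < b - a := sub_pos.2 hab
  have hbound : ∀ t ∈ Ioc (0 : ℝ) 1, |((b - a) - Q t) / μ t - 2| ≤ K / (b - a) * μ t := by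
    intro t ht
    have hpos := hμpos t ht
    have hsq := hK' hGauss hpath hX0 ht (hMint t ht) (hμ t).symm hpos
    rw [hQ' t ht]
    exact abs_sub_integral_max_div_sub_two_le (hMint t ht) (hNint t ht) hc hpos
      hK (hμ t).symm (hμN t ht).symm hsq
  refine tendsto_iff_norm_sub_tendsto_zero.2 (squeeze_zero' (Eventually.of_forall fun t ↦
    norm_nonneg _) (eventually_nhdsWithin_of_forall hbound) ?_)
  simpa using hμlim.const_mul (K / (b - a))
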